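/- arXiv:2001.09469 — 2 statements merged into one kernel-verified Lean document; each statement's English description precedes it below -/
import Mathlib

section
/- Let G be a locally finite simple graph. Let δ : A^*(G) → A^*(G) be a linear operator such that (1) δ(A^r(G)) ⊆ A^{r+1}(G) for every r ≥ 0; (2) δ∘δ = 0; (3) for any α ∈ A^r(G) and β ∈ A^s(G), δ(α∧β) = δα ∧ β + (-1)^r α ∧ δβ; (4) δf = df for every f ∈ A^0(G). Then δ = d, i.e., δα = dα for every α ∈ A^*(G). -/
/-!
Discrete exterior differential calculus on (simple) graphs, following Shi–Yu.

* A tuple of vertices is a *clique tuple* if its entries are pairwise adjacent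
  (hence pairwise distinct, since the graph is simple).
* A `k`-tensor is a real function of `k+1` vertex variables vanishing off
  `(k+1)`-cliques; a `k`-form is a skew-symmetric `k`-tensor.
* `tensorProd` is the tensor product, `skewSym` the skew-symmetrization,
  `wedge` the wedge product `α ∧ β = 𝒜(α ⊗ β)`, and `extD` the exterior
  differential.
-/

open Finset

attribute [local instance] Classical.propDecidable

noncomputable section

variable {V : Type*}

/-- `v₀, …, v_{n-1}` form an `n`-clique of `G` (pairwise adjacent, hence distinct). -/
def IsCliqueTuple (G : SimpleGraph V) {n : ℕ} (v : Fin n → V) : Prop :=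
  ∀ i j : Fin n, i ≠ j → G.Adj (v i) (v j)

/-- A `k`-tensor on `G`: a function of `k+1` vertex variables vanishing whenever the
arguments do not form a `(k+1)`-clique. -/
def IsTensor (G : SimpleGraph V) (k : ℕ) (f : (Fin (k + 1) → V) → ℝ) : Prop :=
  ∀ v : Fin (k + 1) → V, ¬ IsCliqueTuple G v → f v = 0

/-- A `k`-form on `G`: a `k`-tensor that is skew-symmetric in all of its variables. -/
def IsForm (G : SimpleGraph V) (k : ℕ) (f : (Fin (k + 1) → V) → ℝ) : Prop :=
  IsTensor G k f ∧
    ∀ (σ : Equiv.Perm (Fin (k + 1))) (v : Fin (k + 1) → V),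
      f (fun i => v (σ i)) = ((Equiv.Perm.sign σ : ℤ) : ℝ) * f v

/-- Tensor product of an `r`-tensor and an `s`-tensor:
`(α ⊗ β)(v₀,…,v_{r+s}) = α(v₀,…,v_r) β(v_r,…,v_{r+s})` on `(r+s+1)`-cliques, `0` otherwise. -/
def tensorProd (G : SimpleGraph V) (r s : ℕ)
    (α : (Fin (r + 1) → V) → ℝ) (β : (Fin (s + 1) → V) → ℝ) :
    (Fin (r + s + 1) → V) → ℝ :=
  fun v =>
    if IsCliqueTuple G v then
      α (fun i => v (Fin.castLE (by omega) i)) * β (fun i => v ⟨r + i, by omega⟩)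
    else 0

/-- Skew-symmetrization of a `k`-tensor:
`𝒜(f)(v₀,…,v_k) = (1/(k+1)!) ∑_{σ ∈ S_{k+1}} sgn σ · f(v_{σ(0)},…,v_{σ(k)})`. -/
def skewSym (k : ℕ) (f : (Fin (k + 1) → V) → ℝ) : (Fin (k + 1) → V) → ℝ :=
  fun v =>
    ((k + 1).factorial : ℝ)⁻¹ *
      ∑ σ : Equiv.Perm (Fin (k + 1)), ((Equiv.Perm.sign σ : ℤ) : ℝ) * f (fun i => v (σ i))

/-- Wedge product of an `r`-form and an `s`-form: `α ∧ β = 𝒜(α ⊗ β)`. -/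
def wedge (G : SimpleGraph V) (r s : ℕ)
    (α : (Fin (r + 1) → V) → ℝ) (β : (Fin (s + 1) → V) → ℝ) :
    (Fin (r + s + 1) → V) → ℝ :=
  skewSym (r + s) (tensorProd G r s α β)

/-- Exterior differential of an `r`-form:
`dα(v₀,…,v_{r+1}) = ∑ᵢ (-1)ⁱ α(v₀,…,v̂ᵢ,…,v_{r+1})` on `(r+2)`-cliques, `0` otherwise.
For a `0`-form `f` this gives `df(u,v) = f(v) - f(u)` on edges. -/
def extD (G : SimpleGraph V) (r : ℕ) (α : (Fin (r + 1) → V) → ℝ) :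
    (Fin (r + 2) → V) → ℝ :=
  fun v =>
    if IsCliqueTuple G v then
      ∑ i : Fin (r + 2), (-1 : ℝ) ^ (i : ℕ) * α (fun j => v (i.succAbove j))
    else 0

/-- Transport a function of `m` vertex variables along an equality `m = n` of arities. -/
def reindex {m n : ℕ} (h : m = n) (f : (Fin m → V) → ℝ) : (Fin n → V) → ℝ :=
  fun v => f (fun i => v (Fin.cast h i))

/-- Wedge product `f ∧ α` of a `0`-form `f : V → ℝ` with a `k`-form `α`,
reindexed so that the result is again a function of `k+1` vertex variables. -/
def wedge0 (G : SimpleGraph V) (k : ℕ) (f : V → ℝ) (α : (Fin (k + 1) → V) → ℝ) :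
    (Fin (k + 1) → V) → ℝ :=
  reindex (by omega) (wedge G 0 k (fun t => f (t 0)) α)

/-- The characteristic `0`-form `χ^v` of a vertex, as a function of one vertex variable. -/
def chi1 (v : V) : (Fin 1 → V) → ℝ := fun t => if t 0 = v then 1 else 0

/-- The `1`-form `dχ^v`. -/
def dchi (G : SimpleGraph V) (v : V) : (Fin 2 → V) → ℝ :=
  extD G 0 (chi1 v)

/-- The iterated (left-associated) wedge `dχ^{v₁} ∧ dχ^{v₂} ∧ ⋯ ∧ dχ^{v_k}`,
a `k`-form; the empty wedge (`k = 0`) is the constant `1`. -/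
def dchiWedge (G : SimpleGraph V) : ∀ k : ℕ, (Fin k → V) → (Fin (k + 1) → V) → ℝ
  | 0, _ => fun _ => 1
  | 1, vs => dchi G (vs 0)
  | (k + 2), vs =>
      wedge G (k + 1) 1 (dchiWedge G (k + 1) (fun i => vs i.castSucc))
        (dchi G (vs (Fin.last (k + 1))))


/-- A permutation of `Fin (n + 1)` restricts, off a point `i`, to a permutation of `Fin n`. -/
theorem exists_perm_succAbove {n : ℕ} (σ : Equiv.Perm (Fin (n + 1))) (i : Fin (n + 1)) :
    ∃ τ : Equiv.Perm (Fin n), (∀ j, σ (i.succAbove j) = (σ i).succAbove (τ j)) ∧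
      ((Equiv.Perm.sign σ : ℤ) : ℝ) =
        (-1) ^ (i : ℕ) * (-1) ^ (σ i : ℕ) * ((Equiv.Perm.sign τ : ℤ) : ℝ) := by
  obtain ⟨⟨p, τ⟩, hτ⟩ := Equiv.Perm.decomposeFin.symm.surjective
    ((σ i).cycleRange * σ * i.cycleRange⁻¹)
  have hσ : σ = (σ i).cycleRange⁻¹ * Equiv.Perm.decomposeFin.symm (p, τ) * i.cycleRange := by
    rw [hτ]; group
  have hp : p = 0 := by
    have h := congrArg (fun ρ : Equiv.Perm (Fin (n + 1)) => ρ 0) hτ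
    simpa [Equiv.Perm.inv_def] using h
  subst hp
  refine ⟨τ, fun j => ?_, ?_⟩
  · conv_lhs => rw [hσ]
    simp [Equiv.Perm.inv_def]
  · conv_lhs => rw [hσ]
    simp [Equiv.Perm.sign_inv]
    ring

theorem sum_perm_apply {n : ℕ} (h : Fin (n + 1) → ℝ) (k : Fin (n + 1)) :
    ∑ σ : Equiv.Perm (Fin (n + 1)), h (σ k) = (n.factorial : ℝ) * ∑ i, h i := by
  have key : ∀ c, ∑ σ : Equiv.Perm (Fin (n + 1)), h (σ c) =
      ∑ σ : Equiv.Perm (Fin (n + 1)), h (σ k) := fun c =>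
    Fintype.sum_equiv (Equiv.mulRight (Equiv.swap k c)) _ _ fun σ => by simp
  have h1 : ((n : ℝ) + 1) * ∑ σ : Equiv.Perm (Fin (n + 1)), h (σ k) =
      ((n + 1).factorial : ℝ) * ∑ i, h i := by
    calc ((n : ℝ) + 1) * ∑ σ : Equiv.Perm (Fin (n + 1)), h (σ k)
        = ∑ c, ∑ σ : Equiv.Perm (Fin (n + 1)), h (σ c) := by
          simp [key]
      _ = ∑ σ : Equiv.Perm (Fin (n + 1)), ∑ c, h (σ c) := Finset.sum_comm
      _ = _ := by
          simp [Equiv.sum_comp, Finset.card_univ, Fintype.card_perm]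
  rw [Nat.factorial_succ] at h1
  push_cast at h1
  have h2 : (n : ℝ) + 1 ≠ 0 := by positivity
  apply mul_left_cancel₀ h2
  rw [h1, mul_assoc]

theorem sum_perm_apply_mul_apply {n : ℕ} (F g : Fin (n + 1) → ℝ) {a b : Fin (n + 1)}
    (hab : a ≠ b) :
    (n : ℝ) * ∑ σ : Equiv.Perm (Fin (n + 1)), F (σ a) * g (σ b) =
      (n.factorial : ℝ) * ∑ i, (∑ j, F j - F i) * g i := by
  have key : ∀ c ∈ univ.erase b, ∑ σ : Equiv.Perm (Fin (n + 1)), F (σ c) * g (σ b) =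
      ∑ σ : Equiv.Perm (Fin (n + 1)), F (σ a) * g (σ b) := fun c hc =>
    Fintype.sum_equiv (Equiv.mulRight (Equiv.swap a c)) _ _ fun σ => by
      simp [Equiv.swap_apply_of_ne_of_ne hab.symm (Finset.ne_of_mem_erase hc).symm]
  rw [← sum_perm_apply (fun i => (∑ j, F j - F i) * g i) b]
  calc (n : ℝ) * ∑ σ : Equiv.Perm (Fin (n + 1)), F (σ a) * g (σ b)
      = ∑ c ∈ univ.erase b, ∑ σ : Equiv.Perm (Fin (n + 1)), F (σ c) * g (σ b) := by
        rw [Finset.sum_congr rfl key]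
        simp [Finset.card_erase_of_mem]
    _ = ∑ σ : Equiv.Perm (Fin (n + 1)), ∑ c ∈ univ.erase b, F (σ c) * g (σ b) :=
        Finset.sum_comm
    _ = _ := by
        refine Finset.sum_congr rfl fun σ _ => ?_
        rw [← Finset.sum_mul, ← Equiv.sum_comp σ F, ← Finset.sum_erase_eq_sub (Finset.mem_univ b)]

theorem sign_mul_sign {n : ℕ} (σ : Equiv.Perm (Fin n)) :
    ((Equiv.Perm.sign σ : ℤ) : ℝ) * ((Equiv.Perm.sign σ : ℤ) : ℝ) = 1 := by
  rcases Int.units_eq_one_or (Equiv.Perm.sign σ) with h | h <;> simp [h]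

theorem IsCliqueTuple.comp {G : SimpleGraph V} {m n : ℕ} {v : Fin n → V}
    (hv : IsCliqueTuple G v) {e : Fin m → Fin n} (he : Function.Injective e) :
    IsCliqueTuple G (fun i => v (e i)) :=
  fun _ _ hij => hv _ _ (he.ne hij)

theorem isCliqueTuple_comp_perm {G : SimpleGraph V} {n : ℕ} {v : Fin n → V}
    (σ : Equiv.Perm (Fin n)) : IsCliqueTuple G (fun i => v (σ i)) ↔ IsCliqueTuple G v :=
  ⟨fun h => by simpa using h.comp σ.symm.injective, fun h => h.comp σ.injective⟩

/-- Skew-symmetry of a form on the facet of `w ∘ σ` opposite to its `i`-th vertex. -/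
theorem IsForm.apply_perm_succAbove {G : SimpleGraph V} {r : ℕ} {α : (Fin (r + 1) → V) → ℝ}
    (hα : IsForm G r α) (w : Fin (r + 2) → V) (σ : Equiv.Perm (Fin (r + 2))) (i : Fin (r + 2)) :
    (-1) ^ (i : ℕ) * α (fun j => w (σ (i.succAbove j))) =
      ((Equiv.Perm.sign σ : ℤ) : ℝ) *
        ((-1) ^ (σ i : ℕ) * α (fun j => w ((σ i).succAbove j))) := by
  obtain ⟨τ, h1, h2⟩ := exists_perm_succAbove σ i
  simp only [h1, h2]
  rw [hα.2 τ (fun j => w ((σ i).succAbove j))]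
  have h3 : ((-1 : ℝ) ^ (σ i : ℕ)) * (-1) ^ (σ i : ℕ) = 1 := by
    rw [← mul_pow]; simp
  linear_combination (-(-1 : ℝ) ^ (i : ℕ) * ((Equiv.Perm.sign τ : ℤ) : ℝ) *
    α (fun j => w ((σ i).succAbove j))) * h3

theorem IsForm.extD {G : SimpleGraph V} {r : ℕ} {α : (Fin (r + 1) → V) → ℝ}
    (hα : IsForm G r α) : IsForm G (r + 1) (extD G r α) := by
  refine ⟨fun v hv => if_neg hv, fun σ v => ?_⟩
  unfold _root_.extD
  simp only [isCliqueTuple_comp_perm]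
  split_ifs with hv
  · simp only [hα.apply_perm_succAbove]
    rw [← Finset.mul_sum]
    congr 1
    exact Equiv.sum_comp σ fun i : Fin (r + 2) =>
      (-1 : ℝ) ^ (i : ℕ) * α (fun j => v (i.succAbove j))
  · simp

theorem extD_extD (G : SimpleGraph V) (r : ℕ) (α : (Fin (r + 1) → V) → ℝ) :
    extD G (r + 1) (extD G r α) = 0 := by
  funext w
  by_cases hw : IsCliqueTuple G w
  · have hf : ∀ i : Fin (r + 3), IsCliqueTuple G (fun j => w (i.succAbove j)) :=
      fun i => hw.comp i.succAbove_right_injective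
    simp only [extD, if_pos hw, if_pos (hf _), Finset.mul_sum, Pi.zero_apply]
    rw [← Fintype.sum_prod_type']
    have hsign : ∀ p : Fin (r + 3) × Fin (r + 2),
        (-1 : ℝ) ^ (p.1.succAbove p.2 : ℕ) * (-1) ^ (p.2.predAbove p.1 : ℕ) =
          -((-1) ^ (p.1 : ℕ) * (-1) ^ (p.2 : ℕ)) := fun p => by
      rw [← pow_add, ← pow_add, Fin.neg_one_pow_succAbove_add_predAbove]
    refine Finset.sum_involution (fun p _ => (p.1.succAbove p.2, p.2.predAbove p.1)) ?_ ?_ ?_ ?_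
    · rintro ⟨i, j⟩ -
      simp only [Fin.succAbove_succAbove_succAbove_predAbove, ← mul_assoc]
      rw [hsign (i, j)]
      ring
    · rintro ⟨i, j⟩ - - h
      exact Fin.succAbove_ne i j (congrArg Prod.fst h)
    · simp
    · rintro ⟨i, j⟩ -
      simp [Fin.succAbove_succAbove_predAbove, Fin.predAbove_predAbove_succAbove]
  · exact if_neg hw

theorem wedge_zero_right {G : SimpleGraph V} {s : ℕ} {α : (Fin (s + 1) → V) → ℝ}
    (hα : IsForm G s α) (f : (Fin 1 → V) → ℝ) (v : Fin (s + 1) → V) :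
    wedge G s 0 α f v = ((s : ℝ) + 1)⁻¹ * (∑ i, f fun _ => v i) * α v := by
  have hterm : ∀ σ : Equiv.Perm (Fin (s + 1)),
      ((Equiv.Perm.sign σ : ℤ) : ℝ) * tensorProd G s 0 α f (fun i => v (σ i)) =
        α v * f (fun _ => v (σ (Fin.last s))) := fun σ => by
    have h1 : tensorProd G s 0 α f (fun i => v (σ i)) =
        α (fun i => v (σ i)) * f (fun _ => v (σ (Fin.last s))) := by
      unfold tensorProd
      split_ifs with h
      · congr 2
        funext i
        congr 2
        simp
      · rw [hα.1 _ h, zero_mul]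
    rw [h1, hα.2 σ v]
    linear_combination (α v * f (fun _ => v (σ (Fin.last s)))) * sign_mul_sign σ
  have hsum : ∑ σ : Equiv.Perm (Fin (s + 1)),
      ((Equiv.Perm.sign σ : ℤ) : ℝ) * tensorProd G s 0 α f (fun i => v (σ i)) =
        α v * ((s.factorial : ℝ) * ∑ i, f fun _ => v i) := by
    rw [Finset.sum_congr rfl fun σ _ => hterm σ, ← Finset.mul_sum,
      sum_perm_apply (fun i => f fun _ => v i)]
  change ((s + 1).factorial : ℝ)⁻¹ * ∑ σ : Equiv.Perm (Fin (s + 1)),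
      ((Equiv.Perm.sign σ : ℤ) : ℝ) * tensorProd G s 0 α f (fun i => v (σ i)) = _
  rw [hsum, Nat.factorial_succ]
  have : (s.factorial : ℝ) ≠ 0 := by positivity
  push_cast
  field_simp

theorem extD_wedge_zero_right {G : SimpleGraph V} {s : ℕ} {α : (Fin (s + 1) → V) → ℝ}
    (hα : IsForm G s α) (f : (Fin 1 → V) → ℝ) {w : Fin (s + 2) → V} (hw : IsCliqueTuple G w) :
    extD G s (wedge G s 0 α f) w =
      wedge G (s + 1) 0 (extD G s α) f w + (-1) ^ s * wedge G s 1 α (extD G 0 f) w := by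
  set F : Fin (s + 2) → ℝ := fun i => f fun _ => w i with hF
  set g : Fin (s + 2) → ℝ := fun i => (-1) ^ (i : ℕ) * α fun j => w (i.succAbove j) with hg
  have hterm : ∀ σ : Equiv.Perm (Fin (s + 2)),
      ((Equiv.Perm.sign σ : ℤ) : ℝ) * tensorProd G s 1 α (extD G 0 f) (fun i => w (σ i)) =
        (-1) ^ s * (F (σ (Fin.last s).castSucc) * g (σ (Fin.last (s + 1))) -
          F (σ (Fin.last (s + 1))) * g (σ (Fin.last (s + 1)))) := fun σ => by
    have hσ : IsCliqueTuple G (fun i => w (σ i)) := hw.comp σ.injective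
    have h1 : tensorProd G s 1 α (extD G 0 f) (fun i => w (σ i)) =
        α (fun i => w (σ ((Fin.last (s + 1)).succAbove i))) *
          (F (σ (Fin.last (s + 1))) - F (σ (Fin.last s).castSucc)) := by
      have hpair : IsCliqueTuple G fun i : Fin 2 => w (σ ⟨s + i, by omega⟩) :=
        hσ.comp (e := fun i : Fin 2 => (⟨s + i, by omega⟩ : Fin (s + 2))) fun a b h => by
          simpa [Fin.ext_iff] using h
      have hd : extD G 0 f (fun i : Fin 2 => w (σ ⟨s + i, by omega⟩)) =
          F (σ (Fin.last (s + 1))) - F (σ (Fin.last s).castSucc) := by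
        unfold extD
        rw [if_pos hpair, Fin.sum_univ_two]
        simp only [Fin.val_zero, Fin.val_one, pow_zero, pow_one, one_mul, neg_one_mul,
          ← sub_eq_add_neg, hF]
        congr 2 <;> funext j <;> fin_cases j <;> rfl
      unfold tensorProd
      rw [if_pos hσ]
      refine congrArg₂ (· * ·) (congrArg α (funext fun i => ?_)) hd
      rw [Fin.succAbove_last]
      rfl
    have h2 := hα.apply_perm_succAbove w σ (Fin.last (s + 1))
    have h3 : ((-1 : ℝ) ^ s) * (-1) ^ s = 1 := by
      rw [← mul_pow]; simp
    have h4 : ((Equiv.Perm.sign σ : ℤ) : ℝ) *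
        α (fun i => w (σ ((Fin.last (s + 1)).succAbove i))) =
          -(-1) ^ s * g (σ (Fin.last (s + 1))) := by
      rw [Fin.val_last, pow_succ] at h2
      have h5 := sign_mul_sign σ
      change _ = _ * g _ at h2
      generalize α (fun i => w (σ ((Fin.last (s + 1)).succAbove i))) = a at *
      generalize g (σ (Fin.last (s + 1))) = b at *
      generalize ((Equiv.Perm.sign σ : ℤ) : ℝ) = ε at *
      generalize (-1 : ℝ) ^ s = η at *
      linear_combination (-η * ε) * h2 - ε * a * h3 - η * b * h5
    rw [h1, ← mul_assoc, h4]
    ring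
  have hs : (-1 : ℝ) ^ s * (-1) ^ s = 1 := by
    rw [← mul_pow]; simp
  have hwedge : (-1) ^ s * wedge G s 1 α (extD G 0 f) w = ((s + 2).factorial : ℝ)⁻¹ *
      (∑ σ : Equiv.Perm (Fin (s + 2)), F (σ (Fin.last s).castSucc) * g (σ (Fin.last (s + 1))) -
        ((s + 1).factorial : ℝ) * ∑ i, F i * g i) := by
    rw [← sum_perm_apply (fun i => F i * g i) (Fin.last (s + 1)), ← Finset.sum_sub_distrib]
    change _ * (((s + 2).factorial : ℝ)⁻¹ * ∑ σ : Equiv.Perm (Fin (s + 2)),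
      ((Equiv.Perm.sign σ : ℤ) : ℝ) * tensorProd G s 1 α (extD G 0 f) (fun i => w (σ i))) = _
    rw [Finset.sum_congr rfl fun σ _ => hterm σ, ← Finset.mul_sum]
    linear_combination (((s + 2).factorial : ℝ)⁻¹ * ∑ σ : Equiv.Perm (Fin (s + 2)),
      (F (σ (Fin.last s).castSucc) * g (σ (Fin.last (s + 1))) -
        F (σ (Fin.last (s + 1))) * g (σ (Fin.last (s + 1))))) * hs
  have hpairs := sum_perm_apply_mul_apply F g (Fin.castSucc_ne_last (Fin.last s))
  have hleft : extD G s (wedge G s 0 α f) w =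
      ((s : ℝ) + 1)⁻¹ * ∑ i, (∑ j, F j - F i) * g i := by
    unfold extD
    rw [if_pos hw, Finset.mul_sum]
    refine Finset.sum_congr rfl fun i _ => ?_
    rw [wedge_zero_right hα, Fin.sum_univ_succAbove F i]
    simp only [hF, hg]
    ring
  have hmid : wedge G (s + 1) 0 (extD G s α) f w =
      ((s : ℝ) + 2)⁻¹ * (∑ j, F j) * ∑ i, g i := by
    rw [wedge_zero_right hα.extD]
    congr 1
    · push_cast
      ring
    · exact if_pos hw
  have hexp : ∑ i, (∑ j, F j - F i) * g i = (∑ j, F j) * ∑ i, g i - ∑ i, F i * g i := by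
    simp only [sub_mul, Finset.sum_sub_distrib, Finset.mul_sum]
  rw [hexp] at hpairs hleft
  rw [hleft, hmid, hwedge]
  generalize ∑ σ : Equiv.Perm (Fin (s + 2)),
    F (σ (Fin.last s).castSucc) * g (σ (Fin.last (s + 1))) = P at *
  have hP : P = ((s : ℝ) + 1)⁻¹ *
      (((s + 1).factorial : ℝ) * ((∑ j, F j) * ∑ i, g i - ∑ i, F i * g i)) := by
    rw [← hpairs]
    push_cast
    field_simp
  rw [hP, Nat.factorial_succ (s + 1)]
  have : ((s + 1).factorial : ℝ) ≠ 0 := by positivity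
  have : (s : ℝ) + 1 + 1 ≠ 0 := by positivity
  have : (s : ℝ) + 2 ≠ 0 := by positivity
  push_cast
  field_simp
  ring

/-- Contraction of a form with a vertex. -/
def contract (r : ℕ) (x : V) (α : (Fin (r + 2) → V) → ℝ) : (Fin (r + 1) → V) → ℝ :=
  fun u => α (Fin.cons x u)

theorem IsForm.contract {G : SimpleGraph V} {r : ℕ} {α : (Fin (r + 2) → V) → ℝ}
    (hα : IsForm G (r + 1) α) (x : V) : IsForm G r (contract r x α) := by
  refine ⟨fun u hu => hα.1 _ fun h => hu ?_, fun σ u => ?_⟩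
  · simpa using h.comp (Fin.succ_injective (r + 1))
  · have h := hα.2 (Equiv.Perm.decomposeFin.symm (0, σ)) (Fin.cons x u)
    rw [Equiv.Perm.decomposeFin.symm_sign, if_pos rfl, one_mul] at h
    rw [_root_.contract, _root_.contract, ← h]
    congr 1
    funext i
    refine Fin.cases ?_ (fun j => ?_) i <;> simp

theorem extD_contract_apply {G : SimpleGraph V} {r : ℕ} {α : (Fin (r + 2) → V) → ℝ}
    (hα : IsForm G (r + 1) α) (u : Fin (r + 2) → V) :
    extD G r (contract r (u 0) α) u = α u := by
  unfold extD
  split_ifs with hu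
  · rw [Fin.sum_univ_succ, Finset.sum_eq_zero fun i _ => ?_]
    · simp only [Fin.val_zero, pow_zero, one_mul, add_zero, Fin.succAbove_zero, contract]
      exact congrArg α (Fin.cons_self_tail u)
    · rw [contract, hα.1, mul_zero]
      intro h
      refine G.irrefl (v := u 0) ?_
      simpa using h 0 1 (by simp)
  · exact (hα.1 u hu).symm

/-- Multiplying by `χ^x` does not distinguish a form from the differential of its contraction
with `x`. -/
theorem wedge_extD_contract_chi1 {G : SimpleGraph V} {r : ℕ} {α : (Fin (r + 2) → V) → ℝ}
    (hα : IsForm G (r + 1) α) (x : V) :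
    wedge G (r + 1) 0 (extD G r (contract r x α)) (chi1 x) = wedge G (r + 1) 0 α (chi1 x) := by
  have hβ := (hα.contract x).extD
  funext v
  rw [wedge_zero_right hα, wedge_zero_right hβ]
  by_cases hx : ∃ i, v i = x
  · obtain ⟨i, rfl⟩ := hx
    congr 1
    have h := extD_contract_apply hα fun j => v (Equiv.swap 0 i j)
    rw [Equiv.swap_apply_left, hα.2, hβ.2] at h
    refine mul_left_cancel₀ ?_ h
    exact left_ne_zero_of_mul_eq_one (sign_mul_sign _)
  · push Not at hx
    simp [chi1, hx]

theorem isForm_chi1 (G : SimpleGraph V) (x : V) : IsForm G 0 (chi1 x) := by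
  refine ⟨fun v hv => absurd (fun i j hij => ?_) hv, fun σ v => ?_⟩
  · exact absurd (Subsingleton.elim (α := Fin 1) i j) hij
  rw [Subsingleton.elim (α := Equiv.Perm (Fin 1)) σ 1]
  simp

/-- **Uniqueness of exterior differentiation on locally finite graphs.**
Let `G` be a locally finite graph and `δ` a linear operator on forms raising degree by one,
with `δ ∘ δ = 0`, satisfying the graded Leibniz rule, and agreeing with `d` on `0`-forms.
Then `δ = d` on all forms. -/
theorem uniqueness_of_exterior_differentiation
    (G : SimpleGraph V) (hG : ∀ v : V, (G.neighborSet v).Finite)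
    (δ : ∀ r : ℕ, ((Fin (r + 1) → V) → ℝ) → (Fin (r + 2) → V) → ℝ)
    (hmap : ∀ r α, IsForm G r α → IsForm G (r + 1) (δ r α))
    (hadd : ∀ r α β, IsForm G r α → IsForm G r β → δ r (α + β) = δ r α + δ r β)
    (hsmul : ∀ r (c : ℝ) α, IsForm G r α → δ r (c • α) = c • δ r α)
    (hsq : ∀ r α, IsForm G r α → δ (r + 1) (δ r α) = 0)
    (hleib : ∀ r s α β, IsForm G r α → IsForm G s β →
      δ (r + s) (wedge G r s α β) =
        reindex (by omega) (wedge G (r + 1) s (δ r α) β) +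
          (-1 : ℝ) ^ r • wedge G r (s + 1) α (δ s β))
    (h0 : ∀ f : (Fin 1 → V) → ℝ, IsForm G 0 f → δ 0 f = extD G 0 f) :
    ∀ r α, IsForm G r α → δ r α = extD G r α := by
  intro r
  induction r with
  | zero => exact h0
  | succ s ih =>
    intro α hα
    funext w
    by_cases hw : IsCliqueTuple G w
    · set x := w 0 with hx
      have hχ := isForm_chi1 G x
      have hβ := hα.contract x
      have hγ := hβ.extD
      have hδγ : δ (s + 1) (extD G s (contract s x α)) = 0 := by
        rw [← ih _ hβ]
        exact hsq s _ hβ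
      have leib : ∀ ω, IsForm G (s + 1) ω →
          δ (s + 1) (wedge G (s + 1) 0 ω (chi1 x)) w =
            wedge G (s + 2) 0 (δ (s + 1) ω) (chi1 x) w +
              (-1) ^ (s + 1) * wedge G (s + 1) 1 ω (extD G 0 (chi1 x)) w := fun ω hω => by
        have h := congrFun (hleib (s + 1) 0 ω (chi1 x) hω hχ) w
        rw [h0 _ hχ] at h
        exact h
      have e1 := leib α hα
      have e2 := leib _ hγ
      have e3 := extD_wedge_zero_right hα (chi1 x) hw
      have e4 := extD_wedge_zero_right hγ (chi1 x) hw
      rw [wedge_extD_contract_chi1 hα, wedge_zero_right (hmap _ _ hγ), hδγ] at e2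
      rw [wedge_extD_contract_chi1 hα, wedge_zero_right hγ.extD, extD_extD] at e4
      rw [wedge_zero_right (hmap _ _ hα)] at e1
      rw [wedge_zero_right hα.extD] at e3
      simp only [Pi.zero_apply, mul_zero, zero_add] at e2 e4
      have hpos : 0 < ∑ i, chi1 x fun _ => w i := by
        refine Finset.sum_pos' (fun i _ => ?_) ⟨0, Finset.mem_univ _, ?_⟩
        · unfold chi1
          split_ifs <;> norm_num
        · simp [chi1, hx]
      have hne : (((s + 1 + 1 : ℕ) : ℝ) + 1)⁻¹ * ∑ i, chi1 x (fun _ => w i) ≠ 0 :=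
        mul_ne_zero (by positivity) hpos.ne'
      refine mul_left_cancel₀ hne ?_
      linear_combination e2 - e1 + e3 - e4
    · rw [(hmap _ _ hα).1 w hw, hα.extD.1 w hw]

end
end

section
/- Let G be a graph and let δ : A^*(G) → A^*(G) be a linear operator with δ(A^r(G)) ⊆ A^{r+1}(G), δ∘δ = 0, the graded Leibniz rule δ(α∧β) = δα ∧ β + (-1)^r α ∧ δβ for α ∈ A^r(G), β ∈ A^s(G), and δf = df for all 0-forms f. Fix a (k+2)-clique {x₀,x₁,...,x_{k+1}} of G and let ρ be the 0-form with ρ(x_i) = 1 for i = 0,...,k+1 and ρ(x) = 0 for x ∉ {x₀,...,x_{k+1}}. Then for every k-form α on G, δ(ρ ∧ α)(x₀,x₁,...,x_{k+1}) = δα(x₀,x₁,...,x_{k+1}). -/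
/-!
Discrete exterior differential calculus on (simple) graphs, following Shi–Yu.

* A tuple of vertices is a *clique tuple* if its entries are pairwise adjacent
  (hence pairwise distinct, since the graph is simple).
* A `k`-tensor is a real function of `k+1` vertex variables vanishing off
  `(k+1)`-cliques; a `k`-form is a skew-symmetric `k`-tensor.
* `tensorProd` is the tensor product, `skewSym` the skew-symmetrization,
  `wedge` the wedge product `α ∧ β = 𝒜(α ⊗ β)`, and `extD` the exterior
  differential.
-/

open Finset

attribute [local instance] Classical.propDecidable

noncomputable section

variable {V : Type*}

theorem IsCliqueTuple.comp_injective {G : SimpleGraph V} {m n : ℕ} {v : Fin n → V}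
    (hv : IsCliqueTuple G v) {g : Fin m → Fin n} (hg : Function.Injective g) :
    IsCliqueTuple G (fun i => v (g i)) :=
  fun _ _ hij => hv _ _ (hg.ne hij)

/-- A function of one vertex variable is a `0`-form. -/
theorem isForm_zero (G : SimpleGraph V) (f : (Fin 1 → V) → ℝ) : IsForm G 0 f := by
  have : Subsingleton (Fin (0 + 1)) := inferInstanceAs (Subsingleton (Fin 1))
  refine ⟨fun v hv => absurd (fun i j hij => absurd (Subsingleton.elim i j) hij) hv, ?_⟩
  intro σ v
  obtain rfl : σ = 1 := Equiv.ext fun i => Subsingleton.elim _ _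
  simp

/-- Degree-indexed operators commute with transport along an equality of degrees. -/
theorem map_reindex (δ : ∀ r : ℕ, ((Fin (r + 1) → V) → ℝ) → (Fin (r + 2) → V) → ℝ)
    {m n : ℕ} (h : m = n) (f : (Fin (m + 1) → V) → ℝ) :
    δ n (reindex (congrArg (· + 1) h) f) = reindex (congrArg (· + 2) h) (δ m f) := by
  subst h
  rfl

/-- Skew-symmetrization at `v` only depends on the values at the permutations of `v`. -/
theorem skewSym_congr {k : ℕ} {f g : (Fin (k + 1) → V) → ℝ} {v : Fin (k + 1) → V}
    (h : ∀ σ : Equiv.Perm (Fin (k + 1)), f (fun i => v (σ i)) = g (fun i => v (σ i))) :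
    skewSym k f v = skewSym k g v := by
  simp only [skewSym, h]

theorem skewSym_eq_self {G : SimpleGraph V} {k : ℕ} {f : (Fin (k + 1) → V) → ℝ}
    (hf : IsForm G k f) (v : Fin (k + 1) → V) : skewSym k f v = f v := by
  have hsign (σ : Equiv.Perm (Fin (k + 1))) :
      ((Equiv.Perm.sign σ : ℤ) : ℝ) * f (fun i => v (σ i)) = f v := by
    rw [hf.2, ← mul_assoc, ← Int.cast_mul, Int.units_coe_mul_self, Int.cast_one, one_mul]
  simp only [skewSym, hsign, sum_const, card_univ, Fintype.card_perm, Fintype.card_fin,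
    nsmul_eq_mul]
  exact inv_mul_cancel_left₀ (by positivity) _

/-- Wedging with a `0`-form equal to `1` on the vertices of a clique changes nothing there. -/
theorem wedge_zero_left_of_eq_one {G : SimpleGraph V} {k : ℕ} {ρ : V → ℝ}
    {β : (Fin (k + 1) → V) → ℝ} (hβ : IsForm G k β) {v : Fin (0 + k + 1) → V}
    (hv : IsCliqueTuple G v) (hρ : ∀ i, ρ (v i) = 1) :
    wedge G 0 k (fun t => ρ (t 0)) β v = β (fun i => v (Fin.cast (by omega) i)) := by
  have hred : ∀ (m : ℕ) (h : k = m) (v : Fin (m + 1) → V)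
      (f : (Fin (m + 1) → V) → ℝ),
      (∀ σ : Equiv.Perm (Fin (m + 1)),
        f (fun i => v (σ i)) = β (fun i => v (σ (Fin.cast (by omega) i)))) →
      skewSym m f v = β (fun i => v (Fin.cast (by omega) i)) := by
    rintro m rfl v f hf
    exact (skewSym_congr hf).trans (skewSym_eq_self hβ v)
  refine hred (0 + k) (Nat.zero_add k).symm v _ fun σ => ?_
  rw [tensorProd, if_pos (hv.comp_injective σ.injective), hρ, one_mul]
  congr 1
  funext i
  congr 2
  ext
  simp

/-- The wedge product vanishes at a clique on all of whose sub-tuples the left factor does. -/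
theorem wedge_eq_zero_of_left {G : SimpleGraph V} {r s : ℕ} {α : (Fin (r + 1) → V) → ℝ}
    (β : (Fin (s + 1) → V) → ℝ) {v : Fin (r + s + 1) → V}
    (h : ∀ g : Fin (r + 1) → Fin (r + s + 1), α (fun i => v (g i)) = 0) :
    wedge G r s α β v = 0 := by
  have hzero (σ : Equiv.Perm (Fin (r + s + 1))) :
      tensorProd G r s α β (fun i => v (σ i)) = 0 := by
    rw [tensorProd, h fun i => σ (Fin.castLE (by omega) i), zero_mul, ite_self]
  simp only [wedge, skewSym, hzero, mul_zero, sum_const_zero]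

/-- The differential of a `0`-form vanishes on pairs where the form takes equal values. -/
theorem extD_zero_eq_zero {G : SimpleGraph V} {ρ : V → ℝ} {v : Fin 2 → V}
    (h : ρ (v 0) = ρ (v 1)) : extD G 0 (fun t => ρ (t 0)) v = 0 := by
  simp [extD, Fin.sum_univ_two, h]

/-- **Cut-off lemma.** Let `δ` be a linear degree-one operator on forms with `δ² = 0`,
the graded Leibniz rule, and `δ = d` on `0`-forms. If `{x₀,…,x_{k+1}}` is a `(k+2)`-clique
and `ρ` is the `0`-form equal to `1` on the `xᵢ` and `0` elsewhere, then
`δ(ρ ∧ α)(x₀,…,x_{k+1}) = δα(x₀,…,x_{k+1})` for every `k`-form `α`. -/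
theorem cutoff_lemma (G : SimpleGraph V)
    (δ : ∀ r : ℕ, ((Fin (r + 1) → V) → ℝ) → (Fin (r + 2) → V) → ℝ)
    (hmap : ∀ r α, IsForm G r α → IsForm G (r + 1) (δ r α))
    (hadd : ∀ r α β, IsForm G r α → IsForm G r β → δ r (α + β) = δ r α + δ r β)
    (hsmul : ∀ r (c : ℝ) α, IsForm G r α → δ r (c • α) = c • δ r α)
    (hsq : ∀ r α, IsForm G r α → δ (r + 1) (δ r α) = 0)
    (hleib : ∀ r s α β, IsForm G r α → IsForm G s β →
      δ (r + s) (wedge G r s α β) =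
        reindex (by omega) (wedge G (r + 1) s (δ r α) β) +
          (-1 : ℝ) ^ r • wedge G r (s + 1) α (δ s β))
    (h0 : ∀ f : (Fin 1 → V) → ℝ, IsForm G 0 f → δ 0 f = extD G 0 f)
    (k : ℕ) (x : Fin (k + 2) → V) (hx : IsCliqueTuple G x)
    (ρ : V → ℝ) (hρ1 : ∀ i, ρ (x i) = 1) (hρ0 : ∀ y, y ∉ Set.range x → ρ y = 0)
    (α : (Fin (k + 1) → V) → ℝ) (hα : IsForm G k α) :
    δ k (wedge0 G k ρ α) x = δ k α x := by
  have hρ : IsForm G 0 (fun t => ρ (t 0)) := isForm_zero G _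
  rw [wedge0, map_reindex δ (Nat.zero_add k), hleib 0 k _ _ hρ hα, h0 _ hρ]
  simp only [reindex, Pi.add_apply, pow_zero, one_smul]
  rw [wedge_eq_zero_of_left, zero_add]
  · exact wedge_zero_left_of_eq_one (hmap k α hα)
      (hx.comp_injective (Fin.cast_injective _)) fun _ => hρ1 _
  · exact fun _ => extD_zero_eq_zero ((hρ1 _).trans (hρ1 _).symm)

end
end
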